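/- arXiv:2212.07846 — 2 statements merged into one kernel-verified Lean document; each statement's English description precedes it below -/
import Mathlib

section
/- Let Y and H be nonempty finite types, m ∈ ℕ, and S = Y × H × ℝ^m (with the Euclidean norm on ℝ^m). Let (Ω, 𝓕, μ) be a probability space with filtration (𝓕_k)_{k∈ℕ}, let X_k : Ω → S be 𝓕_k-measurable for each k, and let v_k : S → ℝ (k ∈ ℕ) be nonnegative measurable functions such that each v_k(X_k) is integrable and E[v_{k+1}(X_{k+1}) | 𝓕_k] ≤ v_k(X_k) a.e. for every k. Assume X_0 = (y₀, h₀, x₀) a.s. for a fixed state (y₀, h₀, x₀) ∈ S. Then for every ε > 0, v̄(ε) · μ({ω : ∃ k ∈ ℕ, ‖x-component of X_k(ω)‖ > ε}) ≤ v_0(y₀, h₀, x₀). -/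
open MeasureTheory Filter

/-- The infimum `v̄(r)` of the Lyapunov sequence over states whose `x`-component
has norm at least `r`. -/
noncomputable def vbar {Y H : Type*} {m : ℕ}
    (v : ℕ → Y × H × EuclideanSpace ℝ (Fin m) → ℝ) (r : ℝ) : ℝ :=
  sInf {t | ∃ (k : ℕ) (s : Y × H × EuclideanSpace ℝ (Fin m)), r ≤ ‖s.2.2‖ ∧ v k s = t}

/-- **Ville's inequality**: if a nonnegative supermartingale `f` is at least `c` on the adapted
events `B k`, then `c` times the probability that one of them occurs is at most the initial mean. -/
theorem MeasureTheory.Supermartingale.mul_measureReal_iUnion_le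
    {Ω : Type*} {m0 : MeasurableSpace Ω} {μ : Measure Ω} [IsFiniteMeasure μ]
    {𝓕 : Filtration ℕ m0} {f : ℕ → Ω → ℝ} (hf : Supermartingale f 𝓕 μ) (hnonneg : 0 ≤ f)
    {B : ℕ → Set Ω} (hB : ∀ k, MeasurableSet[𝓕 k] (B k)) {c : ℝ}
    (hc : ∀ k, ∀ ω ∈ B k, c ≤ f k ω) :
    c * μ.real (⋃ k, B k) ≤ ∫ ω, f 0 ω ∂μ := by
  have hB' (k) : MeasurableSet (B k) := 𝓕.le k _ (hB k)
  have hA (n) : MeasurableSet[𝓕 n] (Set.accumulate B n) := by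
    rw [Set.accumulate_def]
    exact MeasurableSet.biUnion (Set.to_countable _) fun k hk => 𝓕.mono hk _ (hB k)
  have hlower (k) {s : Set Ω} (hs : MeasurableSet s) (hsB : s ⊆ B k) :
      c * μ.real s ≤ ∫ ω in s, f k ω ∂μ :=
    setIntegral_ge_of_const_le_real hs (measure_ne_top μ s) (fun ω hω => hc k ω (hsB hω))
      (hf.integrable k).integrableOn
  have key (n) : c * μ.real (Set.accumulate B n) + ∫ ω in (Set.accumulate B n)ᶜ, f n ω ∂μ
      ≤ ∫ ω, f 0 ω ∂μ := by
    induction n with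
    | zero =>
      have h0 : Set.accumulate B 0 = B 0 := by simp [Set.accumulate_def]
      rw [h0, ← integral_add_compl (hB' 0) (hf.integrable 0)]
      gcongr
      exact hlower 0 (hB' 0) subset_rfl
    | succ n ih =>
      have hAn := 𝓕.le n _ (hA n)
      have hle := hf.setIntegral_le n.le_succ (hA n).compl
      have hsplit := integral_inter_add_sdiff (s := (Set.accumulate B n)ᶜ) (hB' (n + 1))
        (hf.integrable (n + 1)).integrableOn
      have hnew := hlower (n + 1) (hAn.compl.inter (hB' (n + 1))) Set.inter_subset_right
      have hsucc : Set.accumulate B (n + 1) =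
          Set.accumulate B n ∪ ((Set.accumulate B n)ᶜ ∩ B (n + 1)) := by
        rw [Set.accumulate_succ, Set.union_inter_distrib_left, Set.union_compl_self,
          Set.univ_inter]
      have hcompl : (Set.accumulate B (n + 1))ᶜ = (Set.accumulate B n)ᶜ \ B (n + 1) := by
        rw [Set.accumulate_succ, Set.compl_union, Set.sdiff_eq]
      have hmeas : μ.real (Set.accumulate B (n + 1)) = μ.real (Set.accumulate B n) +
          μ.real ((Set.accumulate B n)ᶜ ∩ B (n + 1)) := by
        rw [hsucc]
        exact measureReal_union (disjoint_compl_right.mono_right Set.inter_subset_left)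
          (hAn.compl.inter (hB' (n + 1)))
      rw [hmeas, hcompl, mul_add]
      linarith
  have hlim : Tendsto (fun n => c * μ.real (Set.accumulate B n)) atTop
      (nhds (c * μ.real (⋃ k, B k))) :=
    ((ENNReal.tendsto_toReal (measure_ne_top μ _)).comp
      tendsto_measure_iUnion_accumulate).const_mul c
  refine le_of_tendsto' hlim fun n => ?_
  have hpos : 0 ≤ ∫ ω in (Set.accumulate B n)ᶜ, f n ω ∂μ := integral_nonneg (hnonneg n)
  linarith [key n]

/-- `vbar v r` is a lower bound of a nonnegative `v` outside the ball of radius `r`. -/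
theorem vbar_le {Y H : Type*} {m : ℕ} {v : ℕ → Y × H × EuclideanSpace ℝ (Fin m) → ℝ}
    (hv : ∀ k s, 0 ≤ v k s) {r : ℝ} (k : ℕ) {s : Y × H × EuclideanSpace ℝ (Fin m)}
    (hs : r ≤ ‖s.2.2‖) : vbar v r ≤ v k s :=
  csInf_le ⟨0, by rintro _ ⟨j, t, -, rfl⟩; exact hv j t⟩ ⟨k, s, hs, rfl⟩

/-- **Discrete-time core of Theorem 1.** If `(v k (X k))` decreases in conditional mean
along the embedded chain, is nonnegative, and the chain starts a.s. at `(y₀, h₀, x₀)`,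
then for every `ε > 0`,
`v̄(ε) * μ {∃ k, ‖x-component of X k‖ > ε} ≤ v 0 (y₀, h₀, x₀)`. -/
theorem lyapunov_exit_probability_bound
    {Y H : Type*} [Finite Y] [Nonempty Y] [Finite H] [Nonempty H]
    [MeasurableSpace Y] [MeasurableSpace H] {m : ℕ}
    {Ω : Type*} {m0 : MeasurableSpace Ω} (μ : Measure Ω) [IsProbabilityMeasure μ]
    (𝓕 : Filtration ℕ m0)
    (X : ℕ → Ω → Y × H × EuclideanSpace ℝ (Fin m))
    (hadp : ∀ k, Measurable[𝓕 k] (X k))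
    (v : ℕ → Y × H × EuclideanSpace ℝ (Fin m) → ℝ)
    (hvmeas : ∀ k, Measurable (v k)) (hvnn : ∀ k s, 0 ≤ v k s)
    (hint : ∀ k, Integrable (fun ω => v k (X k ω)) μ)
    (hsm : ∀ k, μ[fun ω => v (k + 1) (X (k + 1) ω)|𝓕 k] ≤ᵐ[μ] fun ω => v k (X k ω))
    (y₀ : Y) (h₀ : H) (x₀ : EuclideanSpace ℝ (Fin m))
    (hX0 : ∀ᵐ ω ∂μ, X 0 ω = (y₀, h₀, x₀)) :
    ∀ ε > (0 : ℝ),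
      vbar v ε * (μ {ω | ∃ k : ℕ, ε < ‖(X k ω).2.2‖}).toReal ≤ v 0 (y₀, h₀, x₀) := by
  intro ε _
  have hsuper : Supermartingale (fun k ω => v k (X k ω)) 𝓕 μ :=
    supermartingale_nat (fun k => ((hvmeas k).comp (hadp k)).stronglyMeasurable) hint hsm
  have hinit : ∫ ω, v 0 (X 0 ω) ∂μ = v 0 (y₀, h₀, x₀) := by
    rw [integral_congr_ae (hX0.mono fun ω hω => congrArg (v 0) hω)]
    simp
  rw [← hinit, Set.ofPred_exists]
  exact hsuper.mul_measureReal_iUnion_le (fun k ω => hvnn k (X k ω))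
    (fun k => hadp k (measurableSet_lt measurable_const measurable_snd.snd.norm))
    (fun k ω hω => vbar_le hvnn k (le_of_lt hω))
end

section
/- Let c > 0 and let (L_r)_{r∈ℕ} be a sequence of nonnegative real numbers such that L_r ≤ c·(Σ_{q=1}^{r−1} L_q L_{r−q} + L_{r−1}) for every r ≥ 1. Then there exists ε₀ > 0 such that for every ε with 0 ≤ ε < ε₀ the series Σ_{r=0}^{∞} L_r ε^r converges. -/
/-- The partial sums of the self-convolution of a nonnegative sequence, over positive indices, are
bounded by the squares of the partial sums. -/
theorem sum_Ico_convolution_le_sq (a : ℕ → ℝ) (ha : ∀ r, 0 ≤ a r) (n : ℕ) :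
    ∑ r ∈ Finset.Ico 1 (n + 1), ∑ q ∈ Finset.Ico 1 r, a q * a (r - q) ≤
      (∑ r ∈ Finset.Ico 1 n, a r) ^ 2 := by
  have hstep : ∀ q ∈ Finset.Ico 1 (n + 1),
      ∑ r ∈ Finset.Ico (q + 1) (n + 1), a q * a (r - q) ≤
        if q < n then a q * ∑ r ∈ Finset.Ico 1 n, a r else 0 := by
    intro q hq
    rw [Finset.mem_Ico] at hq
    split_ifs with h
    · rw [← Finset.mul_sum]
      refine mul_le_mul_of_nonneg_left ?_ (ha q)
      have hshift : ∑ r ∈ Finset.Ico (q + 1) (n + 1), a (r - q) =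
          ∑ r ∈ Finset.Ico 1 (n + 1 - q), a r := by
        rw [Finset.sum_Ico_eq_sum_range, Finset.sum_Ico_eq_sum_range]
        refine Finset.sum_congr (by congr 1) fun i _ => by congr 1; omega
      rw [hshift]
      exact Finset.sum_le_sum_of_subset_of_nonneg
        (Finset.Ico_subset_Ico_right (by omega)) fun i _ _ => ha i
    · rw [Finset.Ico_eq_empty (by omega), Finset.sum_empty]
  rw [← Finset.sum_Ico_Ico_comm']
  refine (Finset.sum_le_sum hstep).trans_eq ?_
  rw [← Finset.sum_filter, sq, Finset.sum_mul]
  refine Finset.sum_congr ?_ fun _ _ => rfl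
  ext q
  simp only [Finset.mem_filter, Finset.mem_Ico]
  omega

/-- A nonnegative sequence satisfying a quadratic recursive inequality with sufficiently small
linear part is summable. -/
theorem summable_of_le_convolution (c ε : ℝ) (hc : 0 < c) (hε : 0 ≤ ε) (a : ℕ → ℝ)
    (ha : ∀ r, 0 ≤ a r)
    (hrec : ∀ r, 1 ≤ r →
      a r ≤ c * ((∑ q ∈ Finset.Ico 1 r, a q * a (r - q)) + ε * a (r - 1)))
    (M : ℝ) (hM : 0 ≤ M) (hsmall : c * (M ^ 2 + ε * (a 0 + M)) ≤ M) : Summable a := by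
  have hbound : ∀ n, ∑ r ∈ Finset.Ico 1 n, a r ≤ M := by
    intro n
    induction n with
    | zero => simpa using hM
    | succ n ih =>
      have hT : 0 ≤ ∑ r ∈ Finset.Ico 1 n, a r := Finset.sum_nonneg fun i _ => ha i
      have hshift : ∑ r ∈ Finset.Ico 1 (n + 1), a (r - 1) ≤ a 0 + ∑ r ∈ Finset.Ico 1 n, a r := by
        rw [Finset.sum_Ico_eq_sum_range]
        simp only [Nat.add_sub_cancel, Nat.add_sub_cancel_left]
        rcases Nat.eq_zero_or_pos n with rfl | hn
        · simpa using ha 0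
        · rw [Finset.range_eq_Ico, Finset.sum_eq_sum_Ico_succ_bot hn]
      have hsq := sum_Ico_convolution_le_sq a ha n
      calc ∑ r ∈ Finset.Ico 1 (n + 1), a r
          ≤ ∑ r ∈ Finset.Ico 1 (n + 1),
              c * ((∑ q ∈ Finset.Ico 1 r, a q * a (r - q)) + ε * a (r - 1)) :=
            Finset.sum_le_sum fun r hr => hrec r (Finset.mem_Ico.mp hr).1
        _ = c * ((∑ r ∈ Finset.Ico 1 (n + 1), ∑ q ∈ Finset.Ico 1 r, a q * a (r - q)) +
              ε * ∑ r ∈ Finset.Ico 1 (n + 1), a (r - 1)) := by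
            rw [← Finset.mul_sum, Finset.sum_add_distrib, ← Finset.mul_sum]
        _ ≤ c * (M ^ 2 + ε * (a 0 + M)) := by
            refine mul_le_mul_of_nonneg_left (add_le_add (hsq.trans ?_) ?_) hc.le
            · exact pow_le_pow_left₀ hT ih 2
            · exact mul_le_mul_of_nonneg_left (by linarith) hε
        _ ≤ M := hsmall
  refine summable_of_sum_range_le (c := a 0 + M) ha fun n => ?_
  rcases Nat.eq_zero_or_pos n with rfl | hn
  · simpa using add_nonneg (ha 0) hM
  · rw [Finset.range_eq_Ico, Finset.sum_eq_sum_Ico_succ_bot hn]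
    exact add_le_add le_rfl (hbound n)


/-- **Convergence of the majorant series (proof of Theorem 5).** If `L_r ≥ 0` and
`L_r ≤ c (Σ_{q=1}^{r−1} L_q L_{r−q} + L_{r−1})` for every `r ≥ 1`, then the power series
`Σ L_r ε^r` converges for all sufficiently small `ε ≥ 0`. -/
theorem majorant_series_convergence
    (c : ℝ) (hc : 0 < c) (L : ℕ → ℝ) (hLnn : ∀ r, 0 ≤ L r)
    (hrec : ∀ r, 1 ≤ r →
      L r ≤ c * ((∑ q ∈ Finset.Ico 1 r, L q * L (r - q)) + L (r - 1))) :
    ∃ ε₀ > (0 : ℝ), ∀ ε : ℝ, 0 ≤ ε → ε < ε₀ →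
      Summable (fun r : ℕ => L r * ε ^ r) := by
  have hL0 := hLnn 0
  have hM : 0 < 1 / (2 * c) := by positivity
  have hD : 0 < L 0 + 1 / (2 * c) := by linarith
  refine ⟨1 / (4 * c ^ 2 * (L 0 + 1 / (2 * c))), by positivity, fun ε hε hlt => ?_⟩
  refine summable_of_le_convolution c ε hc hε _ (fun r => mul_nonneg (hLnn r) (pow_nonneg hε r))
    (fun r hr => ?_) (1 / (2 * c)) hM.le ?_
  · refine (mul_le_mul_of_nonneg_right (hrec r hr) (pow_nonneg hε r)).trans_eq ?_
    rw [mul_assoc, add_mul, Finset.sum_mul]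
    congr 2
    · refine Finset.sum_congr rfl fun q hq => ?_
      rw [← Nat.add_sub_cancel' (Finset.mem_Ico.mp hq).2.le, pow_add, Nat.add_sub_cancel_left]
      ring
    · obtain ⟨k, rfl⟩ := Nat.exists_eq_add_of_le' hr
      rw [Nat.add_sub_cancel, pow_succ]
      ring
  · simp only [pow_zero, mul_one]
    have hlin : ε * (L 0 + 1 / (2 * c)) ≤ 1 / (4 * c ^ 2) := by
      rw [lt_div_iff₀ (by positivity)] at hlt
      rw [le_div_iff₀ (by positivity)]
      linarith
    calc c * ((1 / (2 * c)) ^ 2 + ε * (L 0 + 1 / (2 * c)))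
        ≤ c * ((1 / (2 * c)) ^ 2 + 1 / (4 * c ^ 2)) := by gcongr
      _ = 1 / (2 * c) := by field_simp; norm_num
end
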